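/- Let V be a finite collection of finite-valued random variables forming a faithful Bayesian network with DAG G, equipped with a bivariate partial information decomposition whose atoms are nonnegative, satisfy the consistency equations, and satisfy monotonicity of unique information, and suppose persistent relevance holds. Then for any distinct X_i, X_j ∈ V: Uniq^{V'}(X_j; X_i) > 0 if and only if X_j is a parent or a child of X_i in G. -/

import Mathlib

open scoped BigOperators

/-- A probability mass function on a finite outcome space `Ω`. -/
structure FinProb (Ω : Type*) [Fintype Ω] where
  p : Ω → ℝ
  nonneg : ∀ ω, 0 ≤ p ω
  sum_one : ∑ ω, p ω = 1

/-- The probability that the finite-valued random variable `X` takes the value `a`. -/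
def prob {Ω : Type*} [Fintype Ω] {α : Type*} [DecidableEq α]
    (μ : FinProb Ω) (X : Ω → α) (a : α) : ℝ :=
  ∑ ω, if X ω = a then μ.p ω else 0

/-- Shannon mutual information `I(X ; Y)` of two finite-valued random variables
(natural logarithm; the convention `0 · log 0 = 0` holds since `Real.log 0 = 0`). -/
noncomputable def MI {Ω : Type*} [Fintype Ω] {α β : Type*}
    [Fintype α] [DecidableEq α] [Fintype β] [DecidableEq β]
    (μ : FinProb Ω) (X : Ω → α) (Y : Ω → β) : ℝ :=
  ∑ a : α, ∑ b : β,
    prob μ (fun ω => (X ω, Y ω)) (a, b) *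
      Real.log (prob μ (fun ω => (X ω, Y ω)) (a, b) /
        (prob μ X a * prob μ Y b))

/-- Conditional mutual information `I(X ; Y ∣ Z)` of finite-valued random variables. -/
noncomputable def condMI {Ω : Type*} [Fintype Ω] {α β γ : Type*}
    [Fintype α] [DecidableEq α] [Fintype β] [DecidableEq β] [Fintype γ] [DecidableEq γ]
    (μ : FinProb Ω) (X : Ω → α) (Y : Ω → β) (Z : Ω → γ) : ℝ :=
  ∑ a : α, ∑ b : β, ∑ c : γ,
    prob μ (fun ω => (X ω, Y ω, Z ω)) (a, b, c) *
      Real.log ((prob μ Z c * prob μ (fun ω => (X ω, Y ω, Z ω)) (a, b, c)) /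
        (prob μ (fun ω => (X ω, Z ω)) (a, c) * prob μ (fun ω => (Y ω, Z ω)) (b, c)))

/-- The joint random variable (supervariable) of the subfamily of `X` indexed by `s`. -/
def jointRV {Ω V α : Type*} [DecidableEq V]
    (X : V → Ω → α) (s : Finset V) : Ω → (V → Option α) :=
  fun ω i => if i ∈ s then some (X i ω) else none

/-- A bivariate partial information decomposition (PID) attached to the family `X`:
for each pair of source index sets `A, B` and target `t` it provides nonnegative atoms
`Red A B t = Red(X_A, X_B ; X_t)`, `Uniq A B t = Uniq(X_A ; X_t ∣ X_B)` and
`Syn A B t = Syn(X_A, X_B ; X_t)` satisfying the consistency equations. -/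
structure BivPID {Ω V α : Type*} [Fintype Ω] [Fintype V] [DecidableEq V]
    [Fintype α] [DecidableEq α] (μ : FinProb Ω) (X : V → Ω → α) where
  Red : Finset V → Finset V → V → ℝ
  Uniq : Finset V → Finset V → V → ℝ
  Syn : Finset V → Finset V → V → ℝ
  red_nonneg : ∀ A B t, 0 ≤ Red A B t
  uniq_nonneg : ∀ A B t, 0 ≤ Uniq A B t
  syn_nonneg : ∀ A B t, 0 ≤ Syn A B t
  consistency_fst : ∀ A B t, MI μ (jointRV X A) (X t) = Red A B t + Uniq A B t
  consistency_snd : ∀ A B t, MI μ (jointRV X B) (X t) = Red A B t + Uniq B A t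
  consistency_joint : ∀ A B t,
    MI μ (jointRV X (A ∪ B)) (X t) =
      Red A B t + Uniq A B t + Uniq B A t + Syn A B t

variable {Ω V α : Type*} [Fintype Ω] [Fintype V] [DecidableEq V] [Fintype α] [DecidableEq α]

/-- Monotonicity of unique information: augmenting the other source with further
variables cannot increase the unique information of a source. -/
def BivPID.UniqMono {μ : FinProb Ω} {X : V → Ω → α} (P : BivPID μ X) : Prop :=
  ∀ A B K t, P.Uniq A (B ∪ K) t ≤ P.Uniq A B t

/-- Information monotonicity: augmenting a source with further variables cannot
decrease the synergy atom containing it. -/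
def BivPID.SynMono {μ : FinProb Ω} {X : V → Ω → α} (P : BivPID μ X) : Prop :=
  ∀ A B K t, P.Syn A B t ≤ P.Syn (A ∪ K) B t

/-- `Uniq^{V'}(X_j ; X_i)` : unique information of `X_j` about the target `X_i`
relative to the supervariable of all the remaining variables. -/
def BivPID.uniqC {μ : FinProb Ω} {X : V → Ω → α} (P : BivPID μ X) (j i : V) : ℝ :=
  P.Uniq {j} (Finset.univ \ {i, j}) i

/-- Persistent relevance: a variable whose conditional mutual information with the
target is positive for every conditioning set has positive unique information. -/
def BivPID.PersistentRelevance {μ : FinProb Ω} {X : V → Ω → α} (P : BivPID μ X) : Prop :=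
  ∀ i t : V, i ≠ t →
    (∀ C : Finset V, C ⊆ Finset.univ \ {i, t} →
      0 < condMI μ (X i) (X t) (jointRV X C)) →
    0 < P.uniqC i t

/-- `a → m ← b` is a collider configuration at `m`. -/
def IsCollider {V : Type*} (adj : V → V → Prop) (a m b : V) : Prop :=
  adj a m ∧ adj b m

/-- A trail (undirected path) in a directed graph: consecutive vertices are adjacent
in one direction or the other, and no vertex repeats. -/
def IsTrail {V : Type*} (adj : V → V → Prop) (p : List V) : Prop :=
  List.Chain' (fun u v => adj u v ∨ adj v u) p ∧ p.Nodup

/-- The interior triple `a - m - b` blocks a trail relative to `C` if `m` is a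
non-collider lying in `C`, or `m` is a collider none of whose descendants
(including `m` itself) lies in `C`. -/
def BlocksAt {V : Type*} (adj : V → V → Prop) (C : Finset V) (a m b : V) : Prop :=
  (¬ IsCollider adj a m b ∧ m ∈ C) ∨
    (IsCollider adj a m b ∧ ∀ d, Relation.ReflTransGen adj m d → d ∉ C)

/-- A trail is blocked by `C` if some consecutive interior triple blocks it. -/
def BlockedTrail {V : Type*} (adj : V → V → Prop) (C : Finset V) (p : List V) : Prop :=
  ∃ a m b, [a, m, b] <:+: p ∧ BlocksAt adj C a m b

/-- d-separation: `C` d-separates `x` from `y` if every trail from `x` to `y`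
is blocked by `C`. -/
def DSep {V : Type*} (adj : V → V → Prop) (C : Finset V) (x y : V) : Prop :=
  ∀ p : List V, IsTrail adj p → p.head? = some x → p.getLast? = some y →
    BlockedTrail adj C p

/-- A directed graph is acyclic if no vertex lies on a directed cycle. -/
def AcyclicDigraph {V : Type*} (adj : V → V → Prop) : Prop :=
  ∀ v, ¬ Relation.TransGen adj v v

/-- The joint distribution of the family `X` factorizes according to the DAG `adj`
as `P(x) = ∏ i P(xᵢ ∣ x_{pa(i)})` : there are nonnegative local conditional pmfs,
each depending only on the corresponding variable and its parents. -/
def Factorizes {Ω V α : Type*} [Fintype Ω] [Fintype V] [DecidableEq V]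
    [Fintype α] [DecidableEq α]
    (μ : FinProb Ω) (X : V → Ω → α) (adj : V → V → Prop) : Prop :=
  ∃ f : V → (V → α) → ℝ,
    (∀ i x, 0 ≤ f i x) ∧
    (∀ i, ∀ x y : V → α, x i = y i → (∀ j, adj j i → x j = y j) → f i x = f i y) ∧
    (∀ i, ∀ x : V → α, ∑ a : α, f i (Function.update x i a) = 1) ∧
    (∀ x : V → α, prob μ (fun ω k => X k ω) x = ∏ k, f k x)

/-- Faithfulness: conditional independence holds exactly for d-separated sets. -/
def Faithful {Ω V α : Type*} [Fintype Ω] [Fintype V] [DecidableEq V]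
    [Fintype α] [DecidableEq α]
    (μ : FinProb Ω) (X : V → Ω → α) (adj : V → V → Prop) : Prop :=
  ∀ A B C : Finset V, Disjoint A B → Disjoint A C → Disjoint B C →
    (condMI μ (jointRV X A) (jointRV X B) (jointRV X C) = 0 ↔
      ∀ a ∈ A, ∀ b ∈ B, DSep adj C a b)

/-! ### Information-theoretic identities -/

section Information

variable {β γ δ ε : Type*} [DecidableEq β] [DecidableEq γ] [DecidableEq δ] [DecidableEq ε]

theorem prob_nonneg (μ : FinProb Ω) (Y : Ω → β) (b : β) : 0 ≤ prob μ Y b :=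
  Finset.sum_nonneg fun ω _ => by split_ifs <;> simp [μ.nonneg ω]

theorem prob_apply_pos (μ : FinProb Ω) (Y : Ω → β) {ω : Ω} (hω : 0 < μ.p ω) :
    0 < prob μ Y (Y ω) :=
  Finset.sum_pos' (fun ω' _ => by split_ifs <;> simp [μ.nonneg ω'])
    ⟨ω, Finset.mem_univ ω, by simpa using hω⟩

/-- Integrating a function of `Y` against its law amounts to integrating over outcomes. -/
theorem sum_prob_mul [Fintype β] (μ : FinProb Ω) (Y : Ω → β) (F : β → ℝ) :
    ∑ b, prob μ Y b * F b = ∑ ω, μ.p ω * F (Y ω) := by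
  simp only [prob, Finset.sum_mul]
  rw [Finset.sum_comm]
  simp

theorem sum_prob [Fintype β] (μ : FinProb Ω) (Y : Ω → β) : ∑ b, prob μ Y b = 1 := by
  simpa [μ.sum_one] using sum_prob_mul μ Y fun _ => 1

theorem sum_prob_prod_left [Fintype β] (μ : FinProb Ω) (Y : Ω → β) (Z : Ω → γ) (c : γ) :
    ∑ b, prob μ (fun ω => (Y ω, Z ω)) (b, c) = prob μ Z c := by
  simp only [prob]
  rw [Finset.sum_comm]
  simp [Prod.ext_iff, ite_and]

/-- The probability of the event `Y = Y ω` depends on `Y` only through its level sets. -/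
theorem prob_apply_congr (μ : FinProb Ω) {Y : Ω → β} {Z : Ω → γ}
    (h : ∀ ω ω', Y ω = Y ω' ↔ Z ω = Z ω') (ω : Ω) : prob μ Y (Y ω) = prob μ Z (Z ω) := by
  simp only [prob, h]

theorem MI_eq_sum [Fintype β] [Fintype γ] (μ : FinProb Ω) (Y : Ω → β) (Z : Ω → γ) :
    MI μ Y Z = ∑ ω, μ.p ω * Real.log (prob μ (fun ω => (Y ω, Z ω)) (Y ω, Z ω) /
      (prob μ Y (Y ω) * prob μ Z (Z ω))) := by
  rw [← sum_prob_mul μ (fun ω => (Y ω, Z ω)) fun x => Real.log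
    (prob μ (fun ω => (Y ω, Z ω)) x / (prob μ Y x.1 * prob μ Z x.2)), Fintype.sum_prod_type]
  rfl

theorem condMI_eq_sum [Fintype β] [Fintype γ] [Fintype δ] (μ : FinProb Ω)
    (W : Ω → β) (Y : Ω → γ) (Z : Ω → δ) :
    condMI μ W Y Z = ∑ ω, μ.p ω * Real.log
      ((prob μ Z (Z ω) * prob μ (fun ω => (W ω, Y ω, Z ω)) (W ω, Y ω, Z ω)) /
        (prob μ (fun ω => (W ω, Z ω)) (W ω, Z ω) * prob μ (fun ω => (Y ω, Z ω)) (Y ω, Z ω))) := by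
  rw [← sum_prob_mul μ (fun ω => (W ω, Y ω, Z ω)) fun x => Real.log
    ((prob μ Z x.2.2 * prob μ (fun ω => (W ω, Y ω, Z ω)) x) /
      (prob μ (fun ω => (W ω, Z ω)) (x.1, x.2.2) *
        prob μ (fun ω => (Y ω, Z ω)) (x.2.1, x.2.2))), Fintype.sum_prod_type]
  simp only [Fintype.sum_prod_type]
  rfl

/-- Conditional mutual information is invariant under relabelling of its first two arguments. -/
theorem condMI_congr {β' γ' : Type*} [DecidableEq β'] [DecidableEq γ'] [Fintype β] [Fintype γ]
    [Fintype δ] [Fintype β'] [Fintype γ'] (μ : FinProb Ω)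
    {W : Ω → β} {W' : Ω → β'} {Y : Ω → γ} {Y' : Ω → γ'} (Z : Ω → δ)
    (hW : ∀ ω ω', W ω = W ω' ↔ W' ω = W' ω') (hY : ∀ ω ω', Y ω = Y ω' ↔ Y' ω = Y' ω') :
    condMI μ W Y Z = condMI μ W' Y' Z := by
  rw [condMI_eq_sum, condMI_eq_sum]
  refine Finset.sum_congr rfl fun ω _ => ?_
  rw [prob_apply_congr μ (Y := fun ω => (W ω, Y ω, Z ω)) (Z := fun ω => (W' ω, Y' ω, Z ω))
      (by simp [hW, hY]),
    prob_apply_congr μ (Y := fun ω => (W ω, Z ω)) (Z := fun ω => (W' ω, Z ω)) (by simp [hW]),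
    prob_apply_congr μ (Y := fun ω => (Y ω, Z ω)) (Z := fun ω => (Y' ω, Z ω)) (by simp [hY])]

/-- Chain rule `I(U ; Y) = I(Z ; Y) + I(W ; Y ∣ Z)`, where `U` carries the same information as
the pair `(W, Z)`. -/
theorem MI_eq_add_condMI [Fintype β] [Fintype γ] [Fintype δ] [Fintype ε] (μ : FinProb Ω)
    {U : Ω → ε} (W : Ω → β) (Y : Ω → γ) (Z : Ω → δ)
    (hU : ∀ ω ω', U ω = U ω' ↔ W ω = W ω' ∧ Z ω = Z ω') :
    MI μ U Y = MI μ Z Y + condMI μ W Y Z := by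
  rw [MI_eq_sum, MI_eq_sum, condMI_eq_sum, ← Finset.sum_add_distrib]
  refine Finset.sum_congr rfl fun ω _ => ?_
  rcases (μ.nonneg ω).eq_or_lt with h | h
  · simp [← h]
  rw [prob_apply_congr μ (Y := fun ω => (U ω, Y ω)) (Z := fun ω => (W ω, Y ω, Z ω))
      (by simp only [Prod.mk.injEq, hU]; tauto),
    prob_apply_congr μ (Y := U) (Z := fun ω => (W ω, Z ω)) (by simp [hU]),
    prob_apply_congr μ (Y := fun ω => (Z ω, Y ω)) (Z := fun ω => (Y ω, Z ω))
      (by simp only [Prod.mk.injEq]; tauto), ← mul_add]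
  have hZ := prob_apply_pos μ Z h
  have hY := prob_apply_pos μ Y h
  have hWYZ := prob_apply_pos μ (fun ω => (W ω, Y ω, Z ω)) h
  have hWZ := prob_apply_pos μ (fun ω => (W ω, Z ω)) h
  have hYZ := prob_apply_pos μ (fun ω => (Y ω, Z ω)) h
  rw [← Real.log_mul (by positivity) (by positivity)]
  congr 2
  field_simp

theorem condMI_nonneg [Fintype β] [Fintype γ] [Fintype δ] (μ : FinProb Ω)
    (W : Ω → β) (Y : Ω → γ) (Z : Ω → δ) : 0 ≤ condMI μ W Y Z := by
  set pWYZ := prob μ fun ω => (W ω, Y ω, Z ω) with hWYZ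
  set pWZ := prob μ fun ω => (W ω, Z ω) with hWZ
  set pYZ := prob μ fun ω => (Y ω, Z ω) with hYZ
  have hjoint : ∑ a, ∑ b, ∑ c, pWYZ (a, b, c) = 1 := by
    rw [← sum_prob μ fun ω => (W ω, Y ω, Z ω)]
    simp only [Fintype.sum_prod_type, hWYZ]
  have hprod : ∑ a, ∑ b, ∑ c, pWZ (a, c) * pYZ (b, c) / prob μ Z c = 1 := by
    calc ∑ a, ∑ b, ∑ c, pWZ (a, c) * pYZ (b, c) / prob μ Z c
        = ∑ c, (∑ a, pWZ (a, c)) * (∑ b, pYZ (b, c)) / prob μ Z c := by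
          simp_rw [Finset.sum_mul_sum, Finset.sum_div]
          exact (Finset.sum_congr rfl fun a _ => Finset.sum_comm).trans Finset.sum_comm
      _ = ∑ c, prob μ Z c := by
          refine Finset.sum_congr rfl fun c _ => ?_
          rw [hWZ, hYZ, sum_prob_prod_left, sum_prob_prod_left, mul_self_div_self]
      _ = 1 := sum_prob μ Z
  have hle : ∑ a, ∑ b, ∑ c, (pWYZ (a, b, c) - pWZ (a, c) * pYZ (b, c) / prob μ Z c) ≤
      condMI μ W Y Z := by
    refine Finset.sum_le_sum fun a _ => Finset.sum_le_sum fun b _ => Finset.sum_le_sum fun c _ => ?_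
    have nZ := prob_nonneg μ Z c
    have nWZ : 0 ≤ pWZ (a, c) := prob_nonneg μ _ _
    have nYZ : 0 ≤ pYZ (b, c) := prob_nonneg μ _ _
    rcases (prob_nonneg μ (fun ω => (W ω, Y ω, Z ω)) (a, b, c)).eq_or_lt with h | h
    · rw [← h, hWYZ, ← h]
      simp only [zero_sub, zero_mul, Left.neg_nonpos_iff]
      positivity
    · obtain ⟨ω, hω, hp⟩ : ∃ ω, (W ω, Y ω, Z ω) = (a, b, c) ∧ 0 < μ.p ω := by
        by_contra! hcon
        exact h.not_ge (Finset.sum_nonpos fun ω _ => by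
          split_ifs with hω
          · exact hcon ω hω
          · exact le_rfl)
      obtain ⟨rfl, rfl, rfl⟩ : W ω = a ∧ Y ω = b ∧ Z ω = c := by simpa using hω
      have hZ := prob_apply_pos μ Z hp
      have hWZ' : 0 < pWZ (W ω, Z ω) := prob_apply_pos μ (fun ω => (W ω, Z ω)) hp
      have hYZ' : 0 < pYZ (Y ω, Z ω) := prob_apply_pos μ (fun ω => (Y ω, Z ω)) hp
      change 0 < pWYZ (W ω, Y ω, Z ω) at h
      refine le_trans (le_of_eq ?_) (mul_le_mul_of_nonneg_left
        (Real.one_sub_inv_le_log_of_pos (x := prob μ Z (Z ω) * pWYZ (W ω, Y ω, Z ω) /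
          (pWZ (W ω, Z ω) * pYZ (Y ω, Z ω))) (by positivity)) h.le)
      rw [← hWYZ]
      field_simp
  simp only [Finset.sum_sub_distrib, hjoint, hprod, sub_self] at hle
  exact hle

end Information

theorem jointRV_eq_iff {Ω V α : Type*} [DecidableEq V] (X : V → Ω → α) (s : Finset V) (ω ω' : Ω) :
    jointRV X s ω = jointRV X s ω' ↔ ∀ v ∈ s, X v ω = X v ω' := by
  simp only [jointRV, funext_iff]
  refine forall_congr' fun v => ?_
  by_cases hv : v ∈ s <;> simp [hv]

/-- A source that is conditionally independent of the target given `C` has no unique information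
relative to `C`. -/
theorem BivPID.uniq_eq_zero_of_condMI_eq_zero {μ : FinProb Ω} {X : V → Ω → α} (P : BivPID μ X)
    (A C : Finset V) (t : V) (h : condMI μ (jointRV X A) (X t) (jointRV X C) = 0) :
    P.Uniq A C t = 0 := by
  have hchain := MI_eq_add_condMI μ (U := jointRV X (A ∪ C)) (jointRV X A) (X t) (jointRV X C)
    (fun ω ω' => by simp only [jointRV_eq_iff, Finset.mem_union, or_imp, forall_and])
  linarith [P.consistency_joint A C t, P.consistency_snd A C t, P.uniq_nonneg A C t,
    P.syn_nonneg A C t]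

/-! ### d-separation in directed acyclic graphs -/

section DSeparation

variable {U : Type*} {adj : U → U → Prop}

theorem BlockedTrail.reverse {C : Finset U} {p : List U} (h : BlockedTrail adj C p) :
    BlockedTrail adj C p.reverse := by
  obtain ⟨a, m, b, hinf, hblock⟩ := h
  refine ⟨b, m, a, by simpa using List.reverse_infix.mpr hinf, ?_⟩
  simpa only [BlocksAt, IsCollider, and_comm (a := adj b m)] using hblock

theorem IsTrail.reverse {p : List U} (h : IsTrail adj p) : IsTrail adj p.reverse := by
  refine ⟨?_, List.nodup_reverse.mpr h.2⟩
  refine List.isChain_reverse.mpr (List.IsChain.imp (fun _ _ => Or.symm) h.1)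

theorem DSep.symm {C : Finset U} {x y : U} (h : DSep adj C x y) : DSep adj C y x := by
  intro p hp hhead hlast
  simpa using (h p.reverse hp.reverse (by simpa using hlast) (by simpa using hhead)).reverse

/-- A trail leaving `x` along an outgoing edge and ending at a non-descendant of `x` contains a
collider that is a descendant of `x`. -/
theorem exists_collider_of_isChain {x y : U} (hxy : ¬ Relation.ReflTransGen adj x y) :
    ∀ (q : List U) (u v : U), Relation.ReflTransGen adj x u → adj u v →
      List.IsChain (fun u v => adj u v ∨ adj v u) (u :: v :: q) →
      (u :: v :: q).getLast? = some y →
      ∃ a m b, [a, m, b] <:+: u :: v :: q ∧ IsCollider adj a m b ∧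
        Relation.TransGen adj x m := by
  intro q
  induction q with
  | nil =>
    intro u v hxu huv _ hlast
    obtain rfl : v = y := by simpa using hlast
    exact absurd (hxu.tail huv) hxy
  | cons w q ih =>
    intro u v hxu huv hchain hlast
    have hchain' := (List.isChain_cons_cons.mp hchain).2
    rcases (List.isChain_cons_cons.mp hchain').1 with hvw | hwv
    · obtain ⟨a, m, b, hinf, h⟩ := ih v w (hxu.tail huv) hvw hchain' (by simpa using hlast)
      exact ⟨a, m, b, hinf.trans (List.suffix_cons u _).isInfix, h⟩
    · exact ⟨u, v, w, (List.prefix_append [u, v, w] q).isInfix, ⟨huv, hwv⟩,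
        Relation.TransGen.tail' hxu huv⟩

/-- The parents of `x` d-separate `x` from every non-adjacent non-descendant. -/
theorem dSep_parents (hacyc : AcyclicDigraph adj) {x y : U}
    (hxy : ¬ Relation.ReflTransGen adj x y) (hyx : ¬ adj y x) {C : Finset U}
    (hC : ∀ v, v ∈ C ↔ adj v x) : DSep adj C x y := by
  intro p hp hhead hlast
  match p, hp, hhead, hlast with
  | [u], _, hhead, hlast =>
    obtain rfl : u = x := by simpa using hhead
    obtain rfl : u = y := by simpa using hlast
    exact absurd .refl hxy
  | u :: v :: q, hp, hhead, hlast =>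
    obtain rfl : u = x := by simpa using hhead
    rcases (List.isChain_cons_cons.mp hp.1).1 with huv | hvu
    · obtain ⟨a, m, b, hinf, hcol, hum⟩ :=
        exists_collider_of_isChain hxy q u v .refl huv hp.1 hlast
      refine ⟨a, m, b, hinf, .inr ⟨hcol, fun d hmd hd => ?_⟩⟩
      exact hacyc u ((hum.trans_left hmd).tail ((hC d).mp hd))
    · match q, hlast with
      | [], hlast =>
        obtain rfl : v = y := by simpa using hlast
        exact absurd hvu hyx
      | w :: q, _ =>
        refine ⟨u, v, w, (List.prefix_append [u, v, w] q).isInfix, .inl ⟨fun hcol => ?_,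
          (hC v).mpr hvu⟩⟩
        exact hacyc u (.tail (.single hcol.1) hvu)

theorem exists_dSep_of_not_adj [Fintype U] (hacyc : AcyclicDigraph adj) {x y : U} (hne : x ≠ y)
    (hxy : ¬ adj x y) (hyx : ¬ adj y x) : ∃ C : Finset U, x ∉ C ∧ y ∉ C ∧ DSep adj C x y := by
  classical
  have hirrefl : ∀ v, ¬ adj v v := fun v hv => hacyc v (.single hv)
  by_cases h : Relation.ReflTransGen adj x y
  · have h' : ¬ Relation.ReflTransGen adj y x := fun h' => by
      rcases Relation.reflTransGen_iff_eq_or_transGen.mp h with heq | ht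
      · exact hne heq.symm
      · exact hacyc x (ht.trans_left h')
    exact ⟨Finset.univ.filter (adj · y), by simpa using hxy, by simpa using hirrefl y,
      (dSep_parents hacyc h' hxy (by simp)).symm⟩
  · exact ⟨Finset.univ.filter (adj · x), by simpa using hirrefl x, by simpa using hyx,
      dSep_parents hacyc h hyx (by simp)⟩

theorem not_dSep_of_adj {C : Finset U} {x y : U} (hne : x ≠ y) (h : adj x y ∨ adj y x) :
    ¬ DSep adj C x y := by
  intro hsep
  obtain ⟨a, m, b, hinf, -⟩ := hsep [x, y] ⟨List.isChain_pair.mpr h, by simpa using hne⟩ rfl rfl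
  simpa using hinf.length_le

end DSeparation

theorem Faithful.condMI_eq_zero_iff {μ : FinProb Ω} {X : V → Ω → α} {adj : V → V → Prop}
    (hfaith : Faithful μ X adj) {x y : V} {C : Finset V} (hne : x ≠ y) (hx : x ∉ C)
    (hy : y ∉ C) : condMI μ (jointRV X {x}) (jointRV X {y}) (jointRV X C) = 0 ↔ DSep adj C x y := by
  simpa using hfaith {x} {y} C (by simpa using hne) (by simpa using hx) (by simpa using hy)

/-- In a faithful Bayesian network, a variable `X_j` has positive
unique information about the target `X_i` (relative to the supervariable
complement) if and only if `X_j` is a parent or a child of `X_i`. -/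
theorem causal_unique_information
    {Ω V α : Type*} [Fintype Ω] [Fintype V] [DecidableEq V] [Fintype α] [DecidableEq α]
    (μ : FinProb Ω) (X : V → Ω → α) (adj : V → V → Prop)
    (hacyc : AcyclicDigraph adj)
    (hfact : Factorizes μ X adj)
    (hfaith : Faithful μ X adj)
    (P : BivPID μ X) (hmono : P.UniqMono) (hpr : P.PersistentRelevance)
    (i j : V) (hij : i ≠ j) :
    0 < P.uniqC j i ↔ (adj j i ∨ adj i j) := by
  have hsingle : ∀ (v : V) (ω ω' : Ω), jointRV X {v} ω = jointRV X {v} ω' ↔ X v ω = X v ω' := by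
    simp [jointRV_eq_iff]
  constructor
  · intro hpos
    by_contra! hadj
    obtain ⟨C, hj, hi, hsep⟩ := exists_dSep_of_not_adj hacyc hij.symm hadj.1 hadj.2
    have hzero := (hfaith.condMI_eq_zero_iff hij.symm hj hi).mpr hsep
    rw [condMI_congr μ _ (fun _ _ => Iff.rfl) (hsingle i)] at hzero
    have hC : C ⊆ Finset.univ \ {i, j} := fun v hv => by
      simp only [Finset.mem_sdiff, Finset.mem_univ, true_and, Finset.mem_insert,
        Finset.mem_singleton, not_or]
      exact ⟨fun h => hi (h ▸ hv), fun h => hj (h ▸ hv)⟩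
    have hle := hmono {j} C (Finset.univ \ {i, j}) i
    rw [Finset.union_eq_right.mpr hC, P.uniq_eq_zero_of_condMI_eq_zero {j} C i hzero] at hle
    exact hpos.not_ge hle
  · intro hadj
    refine hpr j i hij.symm fun C hC => ?_
    have hj : j ∉ C := fun h => by simpa using hC h
    have hi : i ∉ C := fun h => by simpa using hC h
    refine (condMI_nonneg _ _ _ _).lt_of_ne' fun hzero => ?_
    rw [← condMI_congr μ _ (hsingle j) (hsingle i)] at hzero
    exact not_dSep_of_adj hij.symm hadj ((hfaith.condMI_eq_zero_iff hij.symm hj hi).mp hzero)
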